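/- arXiv:0805.4162 — 10 statements merged into one kernel-verified Lean document; each statement's English description precedes it below -/
import Mathlib

section
/- Let k be a field and V a finite-dimensional k-vector space. For any endomorphism A of V, the orthogonal complement, with respect to the trace pairing on End(V), of the subspace {M ∈ End(V) : M(ker A) ⊆ im A} is exactly the subspace {N ∈ End(V) : N∘A = 0 and A∘N = 0}. -/
/-- The trace pairing on endomorphisms of a finite-dimensional space is nondegenerate. -/
theorem LinearMap.eq_zero_of_forall_trace_comp_eq_zero {k V : Type*} [Field k] [AddCommGroup V]
    [Module k V] [FiniteDimensional k V] {B : V →ₗ[k] V}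
    (h : ∀ X : V →ₗ[k] V, LinearMap.trace k V (X ∘ₗ B) = 0) : B = 0 := by
  ext v
  refine (Module.forall_dual_apply_eq_zero_iff k (B v)).1 fun f => ?_
  have hcomp : f.smulRight v ∘ₗ B = (f ∘ₗ B).smulRight v := rfl
  simpa [hcomp, LinearMap.trace_smulRight] using h (f.smulRight v)

/-- The orthogonal complement, with respect to the trace pairing on `End(V)`, of the
subspace `{M : M(ker A) ⊆ im A}` is exactly `{N : N∘A = 0 and A∘N = 0}`. -/
theorem stmt0 (k V : Type*) [Field k] [AddCommGroup V] [Module k V]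
    [FiniteDimensional k V] (A : V →ₗ[k] V) :
    {N : V →ₗ[k] V | ∀ M : V →ₗ[k] V,
        (∀ v : V, A v = 0 → M v ∈ LinearMap.range A) →
        LinearMap.trace k V (M ∘ₗ N) = 0}
      = {N : V →ₗ[k] V | N ∘ₗ A = 0 ∧ A ∘ₗ N = 0} := by
  ext N
  constructor
  · intro h
    refine ⟨LinearMap.eq_zero_of_forall_trace_comp_eq_zero fun X => ?_,
      LinearMap.eq_zero_of_forall_trace_comp_eq_zero fun X => ?_⟩
    · rw [← LinearMap.comp_assoc, LinearMap.trace_comp_comm', ← LinearMap.comp_assoc]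
      exact h (A ∘ₗ X) fun v _ => ⟨X v, rfl⟩
    · rw [← LinearMap.comp_assoc]
      exact h (X ∘ₗ A) fun v hv => by simp [hv]
  · rintro ⟨hNA, hAN⟩ M hM
    have hnil : IsNilpotent (M ∘ₗ N) := by
      refine ⟨2, LinearMap.ext fun v => ?_⟩
      obtain ⟨w, hw⟩ := hM (N v) (LinearMap.congr_fun hAN v)
      have hNw : N (A w) = 0 := LinearMap.congr_fun hNA w
      simp [pow_two, ← hw, hNw]
    exact (LinearMap.isNilpotent_trace_of_isNilpotent hnil).eq_zero
end

section
/- Let k be a field, V a 3-dimensional k-vector space, Λ ⊆ End(V) a 4-dimensional subspace, and Λ^⊥ its orthogonal complement with respect to the trace pairing. Suppose that either (i) there exists A ∈ Λ with rank A = 2 such that every M ∈ Λ satisfies M(ker A) ⊆ im A, or (ii) there exists A ∈ Λ with rank A = 1. Then either (iii) there exist linearly independent B₀, B₁ ∈ Λ^⊥ with rank B₀ = 1 and B₁(ker B₀) ⊆ im B₀, or (iv) there exists B ∈ Λ^⊥ with rank B = 2 such that every M ∈ Λ^⊥ satisfies M(ker B) ⊆ im B. -/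
open Module LinearMap in
/-- The trace functionals on `Λ` coming from a family `L` of endomorphisms, all of which are
trace-orthogonal to some nonzero `A ∈ Λ`, span at most `dim Λ - 1` dimensions. -/
theorem finrank_lt_finrank_ker_add {k V X : Type*} [Field k] [AddCommGroup V] [Module k V]
    [FiniteDimensional k V] [AddCommGroup X] [Module k X] [FiniteDimensional k X]
    (Λ : Submodule k (V →ₗ[k] V)) {A : V →ₗ[k] V} (hA : A ∈ Λ) (hA0 : A ≠ 0)
    (L : X →ₗ[k] V →ₗ[k] V) (hL : ∀ x, trace k V (A ∘ₗ L x) = 0) :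
    ∃ K : Submodule k X, finrank k X < finrank k K + finrank k Λ ∧
      ∀ x ∈ K, ∀ M ∈ Λ, trace k V (M ∘ₗ L x) = 0 := by
  let F : X →ₗ[k] Dual k Λ :=
    { toFun := fun x => trace k V ∘ₗ lcomp k V (L x) ∘ₗ Λ.subtype
      map_add' := fun x y => LinearMap.ext fun M => by
        change trace k V (M.1 ∘ₗ L (x + y)) = trace k V (M.1 ∘ₗ L x) + trace k V (M.1 ∘ₗ L y)
        rw [map_add, comp_add, map_add]
      map_smul' := fun c x => LinearMap.ext fun M => by
        change trace k V (M.1 ∘ₗ L (c • x)) = c • trace k V (M.1 ∘ₗ L x)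
        rw [map_smul, comp_smul, map_smul] }
  have hF : ∀ x (M : Λ), F x M = trace k V (M.1 ∘ₗ L x) := fun _ _ => rfl
  have hlt : range F < ⊤ := by
    refine lt_top_iff_ne_top.2 fun htop => ?_
    have hA0' : (⟨A, hA⟩ : Λ) ≠ 0 := fun h => hA0 (congrArg Subtype.val h)
    apply hA0'
    refine (forall_dual_apply_eq_zero_iff k _).1 fun g => ?_
    obtain ⟨x, rfl⟩ := (htop ▸ Submodule.mem_top : g ∈ range F)
    exact hL x
  refine ⟨ker F, ?_, fun x hx M hM => ?_⟩
  · have h1 := Submodule.finrank_lt hlt.ne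
    rw [Subspace.dual_finrank_eq] at h1
    have h2 := finrank_range_add_finrank_ker F
    omega
  · rw [← hF x ⟨M, hM⟩, mem_ker.1 hx, LinearMap.zero_apply]

open Module LinearMap in
theorem exists_eq_smulRight_of_finrank_range_eq_one {k V : Type*} [Field k] [AddCommGroup V]
    [Module k V] [FiniteDimensional k V] {A : V →ₗ[k] V} (hA : finrank k (range A) = 1) :
    ∃ (φ : Dual k V) (p : V), φ ≠ 0 ∧ p ≠ 0 ∧ A = φ.smulRight p := by
  have e : range A ≃ₗ[k] k := LinearEquiv.ofFinrankEq _ _ (by simp [hA])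
  have hE : A = (e.toLinearMap ∘ₗ A.rangeRestrict).smulRight ((e.symm 1 : range A) : V) := by
    ext v
    have : e (A.rangeRestrict v) • e.symm 1 = A.rangeRestrict v := by
      rw [← map_smul, smul_eq_mul, mul_one, e.symm_apply_apply]
    simpa using (congrArg Subtype.val this).symm
  have hA0 : A ≠ 0 := by
    rintro rfl
    rw [range_zero, finrank_bot] at hA
    exact zero_ne_one hA
  refine ⟨_, _, ?_, ?_, hE⟩
  · intro h
    rw [h] at hE
    exact hA0 (by rw [hE]; ext; simp)
  · intro h
    rw [h] at hE
    exact hA0 (by rw [hE]; ext; simp)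

open Module LinearMap in
theorem finrank_range_smulRight {k V : Type*} [Field k] [AddCommGroup V] [Module k V]
    {φ : Dual k V} {p : V} (hφ : φ ≠ 0) (hp : p ≠ 0) :
    finrank k (range (φ.smulRight p)) = 1 := by
  rw [range_smulRight_apply hφ, finrank_span_singleton hp]

open Module LinearMap in
theorem trace_comp_smulRight {k V : Type*} [Field k] [AddCommGroup V] [Module k V]
    [FiniteDimensional k V] (f : Dual k V) (v : V) (M : V →ₗ[k] V) :
    trace k V (M ∘ₗ f.smulRight v) = f (M v) := by
  have h : M ∘ₗ f.smulRight v = f.smulRight (M v) := by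
    ext w
    simp
  rw [h, trace_smulRight]

open Module LinearMap in
/-- If a rank-one `φ ⊗ p` in `Λ^⊥` is annihilated on both sides by a nonzero `A ∈ Λ`, then the
tangent space to the rank-one locus at `φ ⊗ p` meets `Λ^⊥` in dimension at least two. -/
theorem exists_tangent_of_comp_eq_zero {k V : Type*} [Field k] [AddCommGroup V] [Module k V]
    [FiniteDimensional k V] (hV : finrank k V = 3)
    (Λ : Submodule k (V →ₗ[k] V)) (hΛ : finrank k Λ = 4) {A : V →ₗ[k] V} (hA : A ∈ Λ)
    (hA0 : A ≠ 0) {φ : Dual k V} {p : V} (hφ : φ ≠ 0) (hp : p ≠ 0) (hAp : A p = 0)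
    (hφA : ∀ v, φ (A v) = 0) (hB : ∀ M ∈ Λ, φ (M p) = 0) :
    ∃ B₀ B₁ : V →ₗ[k] V,
        (∀ M ∈ Λ, trace k V (M ∘ₗ B₀) = 0) ∧
        (∀ M ∈ Λ, trace k V (M ∘ₗ B₁) = 0) ∧
        LinearIndependent k ![B₀, B₁] ∧
        finrank k (range B₀) = 1 ∧
        (∀ v : V, B₀ v = 0 → B₁ v ∈ range B₀) := by
  obtain ⟨K, hK, hKtr⟩ := finrank_lt_finrank_ker_add Λ hA hA0
    (X := Dual k V × V)
    (coprod ((smulRightₗ (R := k) (M := V) (M₂ := V)).flip p) (smulRightₗ φ)) (fun x => by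
      rw [coprod_apply, comp_add, map_add]
      change trace k V (A ∘ₗ x.1.smulRight p) + trace k V (A ∘ₗ φ.smulRight x.2) = 0
      rw [trace_comp_smulRight, trace_comp_smulRight, hAp, hφA, map_zero, add_zero])
  rw [finrank_prod, Subspace.dual_finrank_eq, hV, hΛ] at hK
  let S : Submodule k (Dual k V × V) := Submodule.span k (Set.range ![(φ, 0), (0, p)])
  have hS : finrank k S ≤ 2 := by
    exact (finrank_range_le_card (R := k) ![((φ, 0) : Dual k V × V), (0, p)]).trans_eq
      (Fintype.card_fin 2)
  obtain ⟨⟨f, v⟩, hx, hxS⟩ : ∃ x ∈ K, x ∉ S := by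
    by_contra! hc
    have := Submodule.finrank_mono (show K ≤ S from hc)
    omega
  refine ⟨φ.smulRight p, f.smulRight p + φ.smulRight v, fun M hM => (trace_comp_smulRight _ _ _).trans (hB M hM),
    fun M hM => hKtr _ hx M hM, ?_, finrank_range_smulRight hφ hp, fun w hw => ?_⟩
  · obtain ⟨x, hx1⟩ : ∃ x, φ x = 1 := by
      obtain ⟨y, hy⟩ := DFunLike.ne_iff.1 hφ
      exact ⟨(φ y)⁻¹ • y, by simpa using inv_mul_cancel₀ hy⟩
    rw [LinearIndependent.pair_iff' (by
      intro h; exact hp (by simpa [hx1] using congrArg (fun g => g x) h))]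
    intro c hc
    apply hxS
    have hv : v = (c - f x) • p := by
      have := congrArg (fun g => g x) hc
      simp [hx1] at this
      rw [sub_smul, this]; abel
    have hf : f = f x • φ := by
      ext w
      have := congrArg (fun g => g w) hc
      simp only [LinearMap.smul_apply, smulRight_apply, LinearMap.add_apply, hv, smul_smul,
        ← add_smul] at this
      have := smul_left_injective k hp this
      simp only [LinearMap.smul_apply, smul_eq_mul]
      linear_combination -this
    have : ((f, v) : Dual k V × V) = f x • (φ, 0) + (c - f x) • (0, p) := by
      ext1
      · simpa using hf
      · simpa using hv
    rw [this]
    exact S.add_mem (S.smul_mem _ (Submodule.subset_span ⟨0, rfl⟩))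
      (S.smul_mem _ (Submodule.subset_span ⟨1, rfl⟩))
  · have hw' : φ w = 0 := by simpa [hp] using hw
    rw [range_smulRight_apply hφ]
    simpa [hw'] using Submodule.smul_mem _ (f w) (Submodule.mem_span_singleton_self p)


/-- One direction of Proposition `prop:linalg`: if `Λ ⊂ End(V)` (with `dim V = 3`,
`dim Λ = 4`) is tangent to `Σ₂` at a smooth point or meets `Σ₁` nontrivially, then
`Λ^⊥` is tangent to `Σ₁` or tangent to `Σ₂` at a smooth point. -/
theorem stmt3 (k V : Type*) [Field k] [AddCommGroup V] [Module k V]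
    [FiniteDimensional k V] (hV : Module.finrank k V = 3)
    (Λ : Submodule k (V →ₗ[k] V)) (hΛ : Module.finrank k Λ = 4)
    (h : (∃ A ∈ Λ, Module.finrank k (LinearMap.range A) = 2 ∧
            ∀ M ∈ Λ, ∀ v : V, A v = 0 → M v ∈ LinearMap.range A) ∨
         (∃ A ∈ Λ, Module.finrank k (LinearMap.range A) = 1)) :
    (∃ B₀ B₁ : V →ₗ[k] V,
        (∀ M ∈ Λ, LinearMap.trace k V (M ∘ₗ B₀) = 0) ∧
        (∀ M ∈ Λ, LinearMap.trace k V (M ∘ₗ B₁) = 0) ∧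
        LinearIndependent k ![B₀, B₁] ∧
        Module.finrank k (LinearMap.range B₀) = 1 ∧
        (∀ v : V, B₀ v = 0 → B₁ v ∈ LinearMap.range B₀)) ∨
    (∃ B : V →ₗ[k] V,
        (∀ M ∈ Λ, LinearMap.trace k V (M ∘ₗ B) = 0) ∧
        Module.finrank k (LinearMap.range B) = 2 ∧
        (∀ M : V →ₗ[k] V, (∀ N ∈ Λ, LinearMap.trace k V (N ∘ₗ M) = 0) →
          ∀ v : V, B v = 0 → M v ∈ LinearMap.range B)) := by
  open Module LinearMap in
  rcases h with ⟨A, hA, hA2, hM⟩ | ⟨A, hA, hA1⟩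
  · left
    have hrk := finrank_range_add_finrank_ker A
    have hA0 : A ≠ 0 := by
      rintro rfl
      rw [range_zero, finrank_bot] at hA2
      omega
    obtain ⟨p, hpA, hp⟩ := (ker A).exists_mem_ne_zero_of_ne_bot fun h => by
      rw [h, finrank_bot] at hrk
      omega
    obtain ⟨φ, hφ, hφA⟩ := (range A).exists_le_ker_of_lt_top (lt_top_iff_ne_top.2 fun h => by
      rw [h, finrank_top] at hA2
      omega)
    exact exists_tangent_of_comp_eq_zero hV Λ hΛ hA hA0 hφ hp hpA
      (fun v => hφA (mem_range_self A v)) (fun M hMΛ => hφA (hM M hMΛ p hpA))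
  · have hrk := finrank_range_add_finrank_ker A
    have hquot := (range A).finrank_quotient_add_finrank
    obtain ⟨ψ, q, hψ, hq, rfl⟩ := exists_eq_smulRight_of_finrank_range_eq_one hA1
    set A := ψ.smulRight q with hAdef
    have hA0 : A ≠ 0 := by
      intro h
      rw [h, range_zero, finrank_bot] at hA1
      omega
    let L : ((V ⧸ range A) →ₗ[k] ker A) →ₗ[k] V →ₗ[k] V :=
      lcomp k V (range A).mkQ ∘ₗ llcomp k (V ⧸ range A) (ker A) V (ker A).subtype
    have hLapp : ∀ g v, L g v = g ((range A).mkQ v) := fun _ _ => rfl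
    have hAL : ∀ g v, A (L g v) = 0 := fun g v => (g ((range A).mkQ v)).2
    have hLA : ∀ g v, L g (A v) = 0 := fun g v => by
      rw [hLapp, Submodule.mkQ_apply,
        (Submodule.Quotient.mk_eq_zero _).2 (mem_range_self A v), map_zero, Submodule.coe_zero]
    obtain ⟨K, hK, hKtr⟩ := finrank_lt_finrank_ker_add Λ hA hA0 L (fun g => by
      rw [show A ∘ₗ L g = 0 from LinearMap.ext (hAL g), map_zero])
    have hd1 : finrank k (V ⧸ range A) = 2 := by omega
    have hd2 : finrank k (ker A) = 2 := by omega
    rw [finrank_linearMap, hd1, hd2, hΛ] at hK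
    obtain ⟨g, hg, hg0⟩ := K.exists_mem_ne_zero_of_ne_bot fun h => by
      rw [h, finrank_bot] at hK
      omega
    have hBtr := hKtr g hg
    have hB0 : L g ≠ 0 := by
      intro h
      apply hg0
      refine LinearMap.ext fun y => ?_
      obtain ⟨v, rfl⟩ := (range A).mkQ_surjective y
      exact Subtype.ext (by rw [← hLapp, h]; rfl)
    have hAB := hAL g
    have hBA := hLA g
    generalize L g = B at hBtr hB0 hAB hBA
    have hle : range B ≤ ker A := by
      rintro _ ⟨v, rfl⟩
      exact hAB v
    have hle' : range A ≤ ker B := by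
      rintro _ ⟨v, rfl⟩
      exact hBA v
    have hBle := Submodule.finrank_mono hle
    have hBpos : finrank k (range B) ≠ 0 := fun h =>
      hB0 (range_eq_bot.1 (Submodule.finrank_eq_zero.1 h))
    obtain h1 | h2 : finrank k (range B) = 1 ∨ finrank k (range B) = 2 := by omega
    · left
      obtain ⟨φ, p, hφ, hp, rfl⟩ := exists_eq_smulRight_of_finrank_range_eq_one h1
      obtain ⟨y, hy⟩ := DFunLike.ne_iff.1 hφ
      refine exists_tangent_of_comp_eq_zero hV Λ hΛ hA hA0 hφ hp ?_ ?_ ?_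
      · have : φ y • A p = 0 := by simpa only [smulRight_apply, map_smul] using hAB y
        exact (smul_eq_zero.1 this).resolve_left hy
      · exact fun v => (smul_eq_zero.1 (hBA v)).resolve_right hp
      · intro M hM
        rw [← trace_comp_smulRight]
        exact hBtr M hM
    · right
      refine ⟨B, hBtr, h2, fun M hM v hv => ?_⟩
      have hr : range B = ker A := Submodule.eq_of_le_of_finrank_eq hle (by omega)
      have hrkB := finrank_range_add_finrank_ker B
      have hk : range A = ker B := Submodule.eq_of_le_of_finrank_eq hle' (by omega)
      obtain ⟨w, rfl⟩ : v ∈ range A := hk ▸ hv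
      have hMq : ψ (M q) = 0 := by
        rw [← trace_comp_smulRight, trace_comp_comm']
        exact hM A hA
      rw [hr, mem_ker, hAdef]
      simp [hMq]
end

section
/- Let k be a field, V a 3-dimensional k-vector space, Λ ⊆ End(V) a 4-dimensional subspace, and Λ^⊥ its orthogonal complement with respect to the trace pairing. Suppose that either (iii) there exist linearly independent B₀, B₁ ∈ Λ^⊥ with rank B₀ = 1 and B₁(ker B₀) ⊆ im B₀, or (iv) there exists B ∈ Λ^⊥ with rank B = 2 such that every M ∈ Λ^⊥ satisfies M(ker B) ⊆ im B. Then either (i) there exists A ∈ Λ with rank A = 2 such that every M ∈ Λ satisfies M(ker A) ⊆ im A, or (ii) there exists A ∈ Λ with rank A = 1. -/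
/-- The bilinear form `(A, B) ↦ tr (A ∘ B)` on endomorphisms of `V`. -/
noncomputable def endTraceForm (k V : Type*) [Field k] [AddCommGroup V] [Module k V] :
    LinearMap.BilinForm k (V →ₗ[k] V) :=
  (LinearMap.mul k (Module.End k V)).compr₂ (LinearMap.trace k V)

section

variable {k V : Type*} [Field k] [AddCommGroup V] [Module k V]

theorem endTraceForm_isSymm : (endTraceForm k V).IsSymm :=
  ⟨fun A B => LinearMap.trace_mul_comm k A B⟩

theorem trace_comp_smulRight_s4 [FiniteDimensional k V] (A : V →ₗ[k] V) (φ : Module.Dual k V)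
    (v : V) : LinearMap.trace k V (A ∘ₗ φ.smulRight v) = φ (A v) := by
  have h : A ∘ₗ φ.smulRight v = φ.smulRight (A v) := by
    ext x
    simp
  rw [h, LinearMap.trace_smulRight]

theorem endTraceForm_nondegenerate [FiniteDimensional k V] :
    (endTraceForm k V).Nondegenerate := by
  have hrefl : LinearMap.IsRefl (endTraceForm k V) := endTraceForm_isSymm.isRefl
  refine hrefl.nondegenerate_iff_separatingLeft.2 fun A hA => ?_
  ext v
  refine (Module.forall_dual_apply_eq_zero_iff k _).1 fun φ => ?_
  rw [← trace_comp_smulRight_s4]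
  exact hA _

theorem mem_of_forall_trace_eq_zero [FiniteDimensional k V] {Λ : Submodule k (V →ₗ[k] V)}
    {A : V →ₗ[k] V}
    (h : ∀ M : V →ₗ[k] V, (∀ N ∈ Λ, LinearMap.trace k V (N ∘ₗ M) = 0) →
      LinearMap.trace k V (M ∘ₗ A) = 0) : A ∈ Λ := by
  rw [← LinearMap.BilinForm.orthogonal_orthogonal endTraceForm_nondegenerate
    endTraceForm_isSymm.isRefl Λ]
  exact fun M hM => h M hM

theorem finrank_range_smulRight_s4 {φ : Module.Dual k V} (hφ : φ ≠ 0) {v : V} (hv : v ≠ 0) :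
    Module.finrank k (LinearMap.range (φ.smulRight v)) = 1 := by
  rw [LinearMap.range_smulRight_apply hφ]
  exact finrank_span_singleton hv

theorem exists_eq_smulRight_of_finrank_range_eq_one_s4 {B : V →ₗ[k] V}
    (hB : Module.finrank k (LinearMap.range B) = 1) :
    ∃ (φ : Module.Dual k V) (u : V), φ ≠ 0 ∧ u ≠ 0 ∧ B = φ.smulRight u := by
  obtain ⟨u, hu, h⟩ := finrank_eq_one_iff'.1 hB
  have hu' : (u : V) ≠ 0 := by simpa using hu
  obtain ⟨f, hf⟩ := Module.Projective.exists_dual_eq_one k hu'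
  obtain ⟨x, hx⟩ := u.2
  refine ⟨f ∘ₗ B, u, fun h0 => ?_, hu', ?_⟩
  · have := LinearMap.congr_fun h0 x
    simp [hx, hf] at this
  · ext v
    obtain ⟨c, hc⟩ := h ⟨B v, v, rfl⟩
    have hc' : c • (u : V) = B v := congrArg Subtype.val hc
    simp [← hc', hf]

/-- Endomorphisms killing `u` whose range lies in the kernel of `φ`. -/
def killingInto (φ : Module.Dual k V) (u : V) : Submodule k (V →ₗ[k] V) where
  carrier := {A | A u = 0 ∧ φ ∘ₗ A = 0}
  zero_mem' := by simp
  add_mem' := by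
    rintro A B ⟨h₁, h₂⟩ ⟨h₃, h₄⟩
    exact ⟨by simp [h₁, h₃], by rw [LinearMap.comp_add, h₂, h₄, add_zero]⟩
  smul_mem' := by
    rintro c A ⟨h₁, h₂⟩
    exact ⟨by simp [h₁], by rw [LinearMap.comp_smul, h₂, smul_zero]⟩

theorem le_finrank_killingInto [FiniteDimensional k V] {φ : Module.Dual k V} (hφ : φ ≠ 0) (u : V) :
    Module.finrank k V * Module.finrank k V + 1 ≤
      Module.finrank k (killingInto φ u) + 2 * Module.finrank k V := by
  let L : (V →ₗ[k] V) →ₗ[k] V × Module.Dual k V :=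
    (LinearMap.applyₗ u).prod (LinearMap.llcomp k V V k φ)
  let G : V × Module.Dual k V →ₗ[k] k := φ.coprod (-(LinearMap.applyₗ u))
  have hker : LinearMap.ker L = killingInto φ u := by
    ext A
    simp [L, killingInto, LinearMap.ext_iff]
  have hG : Function.Surjective G := by
    intro c
    obtain ⟨x, hx⟩ := LinearMap.surjective hφ c
    exact ⟨(x, 0), by simp [G, hx]⟩
  have hle : LinearMap.range L ≤ LinearMap.ker G := by
    rintro _ ⟨A, rfl⟩
    simp [L, G]
  have h₁ := L.finrank_range_add_finrank_ker
  have h₂ := G.finrank_range_add_finrank_ker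
  have h₃ := Submodule.finrank_mono hle
  rw [LinearMap.range_eq_top.2 hG, finrank_top, Module.finrank_self, Module.finrank_prod,
    Subspace.dual_finrank_eq] at h₂
  rw [hker, Module.finrank_linearMap] at h₁
  omega

theorem trace_comp_eq_zero_of_mem_killingInto [FiniteDimensional k V] {φ : Module.Dual k V} {u : V}
    {A B : V →ₗ[k] V} (hA : A ∈ killingInto φ u) (hB : ∀ v, φ v = 0 → B v ∈ k ∙ u) :
    LinearMap.trace k V (B ∘ₗ A) = 0 := by
  refine (LinearMap.isNilpotent_trace_of_isNilpotent ⟨2, ?_⟩).eq_zero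
  ext v
  obtain ⟨c, hc⟩ := Submodule.mem_span_singleton.1 (hB (A v) (LinearMap.congr_fun hA.2 v))
  simp [pow_two, ← hc, hA.1]

theorem exists_mem_killingInto [FiniteDimensional k V] (hV : Module.finrank k V = 3)
    {Λ : Submodule k (V →ₗ[k] V)} (hΛ : Module.finrank k Λ = 4)
    {φ : Module.Dual k V} {u : V} (hφ : φ ≠ 0) {B : V →ₗ[k] V}
    (h₀ : ∀ M ∈ Λ, LinearMap.trace k V (M ∘ₗ φ.smulRight u) = 0)
    (h₁ : ∀ M ∈ Λ, LinearMap.trace k V (M ∘ₗ B) = 0)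
    (hli : LinearIndependent k ![φ.smulRight u, B])
    (hB : ∀ v, φ v = 0 → B v ∈ k ∙ u) :
    ∃ A ∈ Λ, A ≠ 0 ∧ A ∈ killingInto φ u := by
  let W := Submodule.span k (Set.range ![φ.smulRight u, B])
  have hW : Module.finrank k W = 2 := by simpa using finrank_span_eq_card hli
  have mem_orthogonal : ∀ A : V →ₗ[k] V, LinearMap.trace k V (A ∘ₗ φ.smulRight u) = 0 →
      LinearMap.trace k V (A ∘ₗ B) = 0 → A ∈ (endTraceForm k V).orthogonal W := by
    intro A hA₀ hA₁ M hM
    have hle : W ≤ LinearMap.ker (endTraceForm k V A) := by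
      refine Submodule.span_le.2 ?_
      rintro _ ⟨i, rfl⟩
      fin_cases i
      · exact hA₀
      · exact hA₁
    exact endTraceForm_isSymm.isRefl _ _ (hle hM)
  have hle : Λ ⊔ killingInto φ u ≤ (endTraceForm k V).orthogonal W := by
    refine sup_le (fun A hA => mem_orthogonal A (h₀ A hA) (h₁ A hA))
      fun A hA => mem_orthogonal A ?_ ?_
    · rw [trace_comp_smulRight_s4, hA.1, map_zero]
    · rw [LinearMap.trace_comp_comm']
      exact trace_comp_eq_zero_of_mem_killingInto hA hB
  have hsup := Submodule.finrank_mono hle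
  rw [LinearMap.BilinForm.finrank_orthogonal endTraceForm_nondegenerate,
    Module.finrank_linearMap, hW, hV] at hsup
  have hadd := Submodule.finrank_sup_add_finrank_inf_eq Λ (killingInto φ u)
  have hkill := le_finrank_killingInto hφ u
  rw [hV] at hkill
  have hne : Λ ⊓ killingInto φ u ≠ ⊥ := by
    intro hbot
    rw [hbot, finrank_bot] at hadd
    omega
  obtain ⟨A, ⟨hA, hA'⟩, hA0⟩ := Submodule.exists_mem_ne_zero_of_ne_bot hne
  exact ⟨A, hA, hA0, hA'⟩

end

/-- Converse direction of Proposition `prop:linalg`: if `Λ^⊥` is tangent to `Σ₁` or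
tangent to `Σ₂` at a smooth point, then `Λ` (with `dim V = 3`, `dim Λ = 4`) is tangent
to `Σ₂` at a smooth point or meets `Σ₁` nontrivially. -/
theorem stmt4 (k V : Type*) [Field k] [AddCommGroup V] [Module k V]
    [FiniteDimensional k V] (hV : Module.finrank k V = 3)
    (Λ : Submodule k (V →ₗ[k] V)) (hΛ : Module.finrank k Λ = 4)
    (h : (∃ B₀ B₁ : V →ₗ[k] V,
        (∀ M ∈ Λ, LinearMap.trace k V (M ∘ₗ B₀) = 0) ∧
        (∀ M ∈ Λ, LinearMap.trace k V (M ∘ₗ B₁) = 0) ∧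
        LinearIndependent k ![B₀, B₁] ∧
        Module.finrank k (LinearMap.range B₀) = 1 ∧
        (∀ v : V, B₀ v = 0 → B₁ v ∈ LinearMap.range B₀)) ∨
      (∃ B : V →ₗ[k] V,
        (∀ M ∈ Λ, LinearMap.trace k V (M ∘ₗ B) = 0) ∧
        Module.finrank k (LinearMap.range B) = 2 ∧
        (∀ M : V →ₗ[k] V, (∀ N ∈ Λ, LinearMap.trace k V (N ∘ₗ M) = 0) →
          ∀ v : V, B v = 0 → M v ∈ LinearMap.range B))) :
    (∃ A ∈ Λ, Module.finrank k (LinearMap.range A) = 2 ∧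
        ∀ M ∈ Λ, ∀ v : V, A v = 0 → M v ∈ LinearMap.range A) ∨
    (∃ A ∈ Λ, Module.finrank k (LinearMap.range A) = 1) := by
  rcases h with ⟨B₀, B₁, h₀, h₁, hli, hr, hB⟩ | ⟨B, -, hr, hB⟩
  · obtain ⟨φ, u, hφ, hu, rfl⟩ := exists_eq_smulRight_of_finrank_range_eq_one_s4 hr
    rw [LinearMap.range_smulRight_apply hφ] at hB
    obtain ⟨A, hA, hA0, hAu, hφA⟩ := exists_mem_killingInto hV hΛ hφ h₀ h₁ hli
      fun v hv => hB v (by simp [hv])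
    have hker : k ∙ u ≤ LinearMap.ker A := by simpa using hAu
    have hrange : LinearMap.range A ≤ LinearMap.ker φ := LinearMap.range_le_ker_iff.2 hφA
    have hkerφ := Module.Dual.finrank_ker_add_one_of_ne_zero hφ
    have hle := Submodule.finrank_mono hrange
    have hpos : Module.finrank k (LinearMap.range A) ≠ 0 := by
      rwa [Ne, Submodule.finrank_eq_zero, LinearMap.range_eq_bot]
    have hadd := A.finrank_range_add_finrank_ker
    by_cases hrk : Module.finrank k (LinearMap.range A) = 1
    · exact Or.inr ⟨A, hA, hrk⟩
    · refine Or.inl ⟨A, hA, by omega, fun M hM v hv => ?_⟩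
      have hkerA : k ∙ u = LinearMap.ker A :=
        Submodule.eq_of_le_of_finrank_eq hker (by rw [finrank_span_singleton hu]; omega)
      have hrangeA : LinearMap.range A = LinearMap.ker φ :=
        Submodule.eq_of_le_of_finrank_eq hrange (by omega)
      have hv' : v ∈ k ∙ u := hkerA ▸ LinearMap.mem_ker.2 hv
      obtain ⟨c, rfl⟩ := Submodule.mem_span_singleton.1 hv'
      rw [hrangeA, LinearMap.mem_ker, map_smul, map_smul, ← trace_comp_smulRight_s4, h₀ M hM,
        smul_zero]
  · have hadd := B.finrank_range_add_finrank_ker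
    have hker : LinearMap.ker B ≠ ⊥ := by
      intro hbot
      rw [hbot, finrank_bot] at hadd
      omega
    have hlt : LinearMap.range B < ⊤ := by
      refine lt_top_iff_ne_top.2 fun htop => ?_
      rw [htop, finrank_top] at hr
      omega
    obtain ⟨v, hv, hv0⟩ := Submodule.exists_mem_ne_zero_of_ne_bot hker
    obtain ⟨φ, hφ, hle⟩ := Submodule.exists_le_ker_of_lt_top _ hlt
    refine Or.inr ⟨φ.smulRight v, mem_of_forall_trace_eq_zero fun M hM => ?_,
      finrank_range_smulRight_s4 hφ hv0⟩
    rw [trace_comp_smulRight_s4]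
    exact hle (hB M hM v hv)
end

section
/- The lattice J₁₂ represents -10: the vector ρ₁ = (3,-2) satisfies q(ρ₁) = -10. Moreover, every vector v = (a,b) ∈ ℤ² with q(v) = -10 is primitive (gcd(a,b) = 1), and for every such v and every w ∈ ℤ² the pairing B(v,w) is an even integer. -/
/-- The lattice `J₁₂` represents `-10`: `q(3,-2) = -10`; every `v = (a,b)` with
`q(v) = -10` is primitive, and pairs evenly with every `w = (a',b') ∈ ℤ²`. -/
theorem stmt8 :
    (6 * (3 : ℤ) ^ 2 + 12 * 3 * (-2) + 2 * (-2) ^ 2 = -10) ∧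
    ∀ a b : ℤ, 6 * a ^ 2 + 12 * a * b + 2 * b ^ 2 = -10 →
      Int.gcd a b = 1 ∧
      ∀ a' b' : ℤ, (2 : ℤ) ∣ (6 * a * a' + 6 * (a * b' + a' * b) + 2 * b * b') := by
  refine ⟨by norm_num, fun a b h => ⟨?_, fun a' b' =>
    ⟨3 * a * a' + 3 * (a * b' + a' * b) + b * b', by ring⟩⟩⟩
  have hdvd : (Int.gcd a b : ℤ) * Int.gcd a b ∣ 5 := by
    obtain ⟨x, hx⟩ := Int.gcd_dvd_left a b
    obtain ⟨y, hy⟩ := Int.gcd_dvd_right a b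
    generalize (Int.gcd a b : ℤ) = d at hx hy ⊢
    subst hx hy
    exact ⟨-(3 * x ^ 2 + 6 * x * y + y ^ 2), by linarith⟩
  have hdvd' : Int.gcd a b * Int.gcd a b ∣ 5 := by exact_mod_cast hdvd
  exact Nat.isUnit_iff.mp (Nat.prime_five.prime.squarefree _ hdvd')
end

section
/- The group of invertible 2×2 integer matrices M satisfying Mᵀ · !![6,6;6,2] · M = !![6,6;6,2] (the automorphism group of the lattice J₁₂), under matrix multiplication, is isomorphic as a group to the direct product of ℤˣ (the group {±1}) and the infinite dihedral group (DihedralGroup 0). -/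
open Matrix
/-- The automorphism group of the lattice `J₁₂`: invertible integer `2×2` matrices `M`
with `Mᵀ · !![6,6;6,2] · M = !![6,6;6,2]`, as a subgroup of `GL (Fin 2) ℤ`. -/
def autJ12 : Subgroup (GL (Fin 2) ℤ) where
  carrier := {M : GL (Fin 2) ℤ |
    (M : Matrix (Fin 2) (Fin 2) ℤ)ᵀ * !![6, 6; 6, 2] * (M : Matrix (Fin 2) (Fin 2) ℤ)
      = !![6, 6; 6, 2]}
  one_mem' := by simp
  mul_mem' := by
    intro a b ha hb
    simp only [Set.mem_setOf_eq, Units.val_mul, Matrix.transpose_mul] at *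
    calc (b : Matrix (Fin 2) (Fin 2) ℤ)ᵀ * (a : Matrix (Fin 2) (Fin 2) ℤ)ᵀ * !![6, 6; 6, 2]
          * ((a : Matrix (Fin 2) (Fin 2) ℤ) * (b : Matrix (Fin 2) (Fin 2) ℤ))
        = (b : Matrix (Fin 2) (Fin 2) ℤ)ᵀ
            * ((a : Matrix (Fin 2) (Fin 2) ℤ)ᵀ * !![6, 6; 6, 2] * (a : Matrix (Fin 2) (Fin 2) ℤ))
            * (b : Matrix (Fin 2) (Fin 2) ℤ) := by
          simp only [Matrix.mul_assoc]
      _ = !![6, 6; 6, 2] := by rw [ha, hb]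
  inv_mem' := by
    intro a ha
    simp only [Set.mem_setOf_eq] at *
    have h1 : (a : Matrix (Fin 2) (Fin 2) ℤ) * ((a⁻¹ : GL (Fin 2) ℤ) : Matrix (Fin 2) (Fin 2) ℤ)
        = 1 := by
      rw [← Units.val_mul, mul_inv_cancel, Units.val_one]
    have key : ((a⁻¹ : GL (Fin 2) ℤ) : Matrix (Fin 2) (Fin 2) ℤ)ᵀ
          * ((a : Matrix (Fin 2) (Fin 2) ℤ)ᵀ * !![6, 6; 6, 2] * (a : Matrix (Fin 2) (Fin 2) ℤ))
          * ((a⁻¹ : GL (Fin 2) ℤ) : Matrix (Fin 2) (Fin 2) ℤ)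
        = !![6, 6; 6, 2] := by
      rw [show ((a⁻¹ : GL (Fin 2) ℤ) : Matrix (Fin 2) (Fin 2) ℤ)ᵀ
            * ((a : Matrix (Fin 2) (Fin 2) ℤ)ᵀ * !![6, 6; 6, 2] * (a : Matrix (Fin 2) (Fin 2) ℤ))
            * ((a⁻¹ : GL (Fin 2) ℤ) : Matrix (Fin 2) (Fin 2) ℤ)
          = ((a : Matrix (Fin 2) (Fin 2) ℤ)
              * ((a⁻¹ : GL (Fin 2) ℤ) : Matrix (Fin 2) (Fin 2) ℤ))ᵀ * !![6, 6; 6, 2]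
              * ((a : Matrix (Fin 2) (Fin 2) ℤ)
                  * ((a⁻¹ : GL (Fin 2) ℤ) : Matrix (Fin 2) (Fin 2) ℤ)) by
        rw [Matrix.transpose_mul]; simp only [Matrix.mul_assoc]]
      rw [h1, Matrix.transpose_one, Matrix.one_mul, Matrix.mul_one]
    rw [ha] at key
    exact key

namespace J12

open Pell

/-- The matrix of multiplication by `p + q√6`, a unit of norm one in `ℤ[√6]`, on `J₁₂`, where
`(a, b)` is identified with `(3a + b) + a√6`. -/
def rotation : Solution₁ 6 →* Matrix (Fin 2) (Fin 2) ℤ where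
  toFun u := !![u.x + 3 * u.y, u.y; -3 * u.y, u.x - 3 * u.y]
  map_one' := by simp [Matrix.one_fin_two]
  map_mul' u v := by
    ext i j
    fin_cases i <;> fin_cases j <;> simp [Matrix.mul_apply, Fin.sum_univ_two] <;> ring

theorem rotation_apply (u : Solution₁ 6) :
    rotation u = !![u.x + 3 * u.y, u.y; -3 * u.y, u.x - 3 * u.y] := rfl

/-- The matrix of the conjugation `√6 ↦ -√6` on `J₁₂`. -/
def conjugation : Matrix (Fin 2) (Fin 2) ℤ := !![-1, 0; 6, 1]

theorem conjugation_mul_self : conjugation * conjugation = 1 := by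
  decide

theorem rotation_mul_conjugation (u : Solution₁ 6) :
    rotation u * conjugation = conjugation * rotation u⁻¹ := by
  ext i j
  fin_cases i <;> fin_cases j <;>
    simp [rotation_apply, conjugation, Matrix.mul_apply, Fin.sum_univ_two] <;> ring

theorem rotation_isometry (u : Solution₁ 6) :
    (rotation u)ᵀ * !![6, 6; 6, 2] * rotation u = !![6, 6; 6, 2] := by
  have h := u.prop
  ext i j
  fin_cases i <;> fin_cases j <;>
    simp [rotation_apply, Matrix.mul_apply, Fin.sum_univ_two] <;> grind

theorem conjugation_isometry :
    conjugationᵀ * !![6, 6; 6, 2] * conjugation = !![6, 6; 6, 2] := by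
  decide

theorem conjugation_mul_rotation_isometry (u : Solution₁ 6) :
    (conjugation * rotation u)ᵀ * !![6, 6; 6, 2] * (conjugation * rotation u)
      = !![6, 6; 6, 2] := by
  calc (conjugation * rotation u)ᵀ * !![6, 6; 6, 2] * (conjugation * rotation u)
      = (rotation u)ᵀ * (conjugationᵀ * !![6, 6; 6, 2] * conjugation) * rotation u := by
        simp only [Matrix.transpose_mul, Matrix.mul_assoc]
    _ = !![6, 6; 6, 2] := by rw [conjugation_isometry, rotation_isometry]

theorem rotation_injective : Function.Injective rotation := by
  intro u v h
  have h₁ : u.y = v.y := congrFun (congrFun h 0) 1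
  have h₀ : u.x + 3 * u.y = v.x + 3 * v.y := congrFun (congrFun h 0) 0
  exact Solution₁.ext (by omega) h₁

theorem conjugation_mul_rotation_ne_one (u : Solution₁ 6) : conjugation * rotation u ≠ 1 := by
  intro h
  have h₀ := congrFun (congrFun h 0) 0
  have h₁ := congrFun (congrFun h 0) 1
  have h₂ := congrFun (congrFun h 1) 1
  simp [rotation_apply, conjugation, Matrix.mul_apply, Fin.sum_univ_two] at h₀ h₁ h₂
  omega

/-- Every isometry of `J₁₂` is a rotation, or a rotation followed by the conjugation. -/
theorem exists_rotation_of_isometry {M : Matrix (Fin 2) (Fin 2) ℤ}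
    (hM : Mᵀ * !![6, 6; 6, 2] * M = !![6, 6; 6, 2]) :
    ∃ u, M = rotation u ∨ M = conjugation * rotation u := by
  obtain ⟨a, b, c, d, rfl⟩ : ∃ a b c d, M = !![a, b; c, d] := ⟨_, _, _, _, M.eta_fin_two⟩
  have h₀ := congrFun (congrFun hM 0) 0
  have h₁ := congrFun (congrFun hM 0) 1
  have h₂ := congrFun (congrFun hM 1) 1
  simp [Matrix.mul_apply, Fin.sum_univ_two] at h₀ h₁ h₂
  -- `M` sends `1` to `p + b√6` and `√6` to `X + Y√6`
  obtain ⟨p, rfl⟩ : ∃ p, d = p - 3 * b := ⟨d + 3 * b, by ring⟩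
  obtain ⟨Y, rfl⟩ : ∃ Y, a = Y + 3 * b := ⟨a - 3 * b, by ring⟩
  obtain ⟨X, rfl⟩ : ∃ X, c = X - 3 * Y + 3 * p - 9 * b := ⟨c + 3 * Y - 3 * p + 9 * b, by ring⟩
  have hp : p ^ 2 - 6 * b ^ 2 = 1 := by linarith
  have hXY : p * X = 6 * (b * Y) := by linarith
  have hN : X ^ 2 - 6 * Y ^ 2 = -6 := by linarith
  have hp0 : p ≠ 0 := by
    rintro rfl
    nlinarith
  have hY : Y ^ 2 = p ^ 2 := by
    have hsq : (p * X) ^ 2 = (6 * (b * Y)) ^ 2 := by rw [hXY]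
    nlinarith
  rcases sq_eq_sq_iff_eq_or_eq_neg.mp hY with rfl | rfl
  · obtain rfl : X = 6 * b := mul_left_cancel₀ hp0 (by linarith)
    refine ⟨Solution₁.mk Y b hp, .inl ?_⟩
    ext i j
    fin_cases i <;> fin_cases j <;> simp [rotation_apply]
    ring
  · obtain rfl : X = -6 * b := mul_left_cancel₀ hp0 (by linarith)
    refine ⟨Solution₁.mk p (-b) (by simpa using hp), .inr ?_⟩
    ext i j
    fin_cases i <;> fin_cases j <;>
      simp [rotation_apply, conjugation, Matrix.mul_apply, Fin.sum_univ_two] <;> ring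

/-- The fundamental unit `5 + 2√6`. -/
def fundamentalUnit : Solution₁ 6 := Solution₁.mk 5 2 (by norm_num)

theorem isFundamental_fundamentalUnit : IsFundamental fundamentalUnit := by
  refine ⟨by simp [fundamentalUnit], by simp [fundamentalUnit], fun {b} hb => ?_⟩
  simp only [fundamentalUnit, Solution₁.x_mk]
  by_contra! hlt
  have h := b.prop
  generalize b.x = x at *
  generalize b.y = y at *
  have hy : y ^ 2 < 4 := by nlinarith
  have hy₁ : -2 < y := by nlinarith
  have hy₂ : y < 2 := by nlinarith
  interval_cases x <;> interval_cases y <;> omega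

/-- The embedding of `{±1}` in the units of norm one of `ℤ[√6]`. -/
def signUnit : ℤˣ →* Solution₁ 6 where
  toFun s := Solution₁.mk s 0 (by simp [← Units.val_pow_eq_pow_val])
  map_one' := Solution₁.ext (by simp) (by simp)
  map_mul' s t := Solution₁.ext (by simp) (by simp)

/-- The parametrization `(s, n) ↦ s (5 + 2√6) ^ n` of the units of norm one of `ℤ[√6]`. -/
def unitParam (s : ℤˣ) (n : ℤ) : Solution₁ 6 := signUnit s * fundamentalUnit ^ n

theorem unitParam_mul (s t : ℤˣ) (m n : ℤ) :
    unitParam s m * unitParam t n = unitParam (s * t) (m + n) := by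
  rw [unitParam, unitParam, unitParam, map_mul, _root_.zpow_add]
  exact mul_mul_mul_comm _ _ _ _

theorem unitParam_inv (s : ℤˣ) (n : ℤ) : (unitParam s n)⁻¹ = unitParam s (-n) := by
  rw [inv_eq_iff_mul_eq_one, unitParam_mul]
  simp [unitParam]

theorem unitParam_eq_one {s : ℤˣ} {n : ℤ} (h : unitParam s n = 1) : s = 1 ∧ n = 0 := by
  have hx := congrArg Solution₁.x h
  have hy := congrArg Solution₁.y h
  have hpos := Solution₁.x_zpow_pos isFundamental_fundamentalUnit.x_pos n
  have hs : s = 1 := by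
    rcases Int.units_eq_one_or s with rfl | rfl
    · rfl
    · simp [unitParam, signUnit] at hx
      omega
  subst hs
  refine ⟨rfl, isFundamental_fundamentalUnit.y_strictMono.injective ?_⟩
  simpa [unitParam] using hy

theorem unitParam_surjective (u : Solution₁ 6) : ∃ s n, u = unitParam s n := by
  obtain ⟨n, rfl | rfl⟩ := isFundamental_fundamentalUnit.eq_zpow_or_neg_zpow u
  · exact ⟨1, n, by simp [unitParam]⟩
  · exact ⟨-1, n, Solution₁.ext (by simp [unitParam, signUnit]) (by simp [unitParam, signUnit])⟩

theorem rotation_mul_rotation (s t : ℤˣ) (m n : ℤ) :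
    rotation (unitParam s m) * rotation (unitParam t n) = rotation (unitParam (s * t) (m + n)) := by
  rw [← map_mul, unitParam_mul]

theorem rotation_mul_reflection (s t : ℤˣ) (m n : ℤ) :
    rotation (unitParam s m) * (conjugation * rotation (unitParam t n)) =
      conjugation * rotation (unitParam (s * t) (n - m)) := by
  rw [← Matrix.mul_assoc, rotation_mul_conjugation, unitParam_inv, Matrix.mul_assoc,
    rotation_mul_rotation, neg_add_eq_sub]

theorem reflection_mul_rotation (s t : ℤˣ) (m n : ℤ) :
    conjugation * rotation (unitParam s m) * rotation (unitParam t n) =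
      conjugation * rotation (unitParam (s * t) (m + n)) := by
  rw [Matrix.mul_assoc, rotation_mul_rotation]

theorem reflection_mul_reflection (s t : ℤˣ) (m n : ℤ) :
    conjugation * rotation (unitParam s m) * (conjugation * rotation (unitParam t n)) =
      rotation (unitParam (s * t) (n - m)) := by
  rw [Matrix.mul_assoc, rotation_mul_reflection, ← Matrix.mul_assoc, conjugation_mul_self,
    Matrix.one_mul]

/-- The action of `{±1} × D∞` on `J₁₂`. -/
def action : ℤˣ × DihedralGroup 0 →* Matrix (Fin 2) (Fin 2) ℤ where
  toFun
    | (s, .r n) => rotation (unitParam s n)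
    | (s, .sr n) => conjugation * rotation (unitParam s n)
  map_one' := by
    change rotation (unitParam 1 0) = 1
    simp [unitParam]
  map_mul' := by
    rintro ⟨s, m | m⟩ ⟨t, n | n⟩
    · exact (rotation_mul_rotation s t m n).symm
    · exact (rotation_mul_reflection s t m n).symm
    · exact (reflection_mul_rotation s t m n).symm
    · exact (reflection_mul_reflection s t m n).symm

theorem action_isometry (g : ℤˣ × DihedralGroup 0) :
    (action g)ᵀ * !![6, 6; 6, 2] * action g = !![6, 6; 6, 2] := by
  obtain ⟨s, n | n⟩ := g
  · exact rotation_isometry _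
  · exact conjugation_mul_rotation_isometry _

theorem action_eq_one {g : ℤˣ × DihedralGroup 0} (h : action g = 1) : g = 1 := by
  obtain ⟨s, n | n⟩ := g
  · obtain ⟨rfl, hn⟩ := unitParam_eq_one (rotation_injective (h.trans (map_one rotation).symm))
    exact congrArg (fun k : ℤ => ((1 : ℤˣ), DihedralGroup.r (n := 0) k)) hn
  · exact absurd h (conjugation_mul_rotation_ne_one _)

theorem exists_action_eq {M : Matrix (Fin 2) (Fin 2) ℤ}
    (hM : Mᵀ * !![6, 6; 6, 2] * M = !![6, 6; 6, 2]) : ∃ g, action g = M := by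
  obtain ⟨u, hu⟩ := exists_rotation_of_isometry hM
  obtain ⟨s, n, rfl⟩ := unitParam_surjective u
  rcases hu with rfl | rfl
  · exact ⟨(s, .r n), rfl⟩
  · exact ⟨(s, .sr n), rfl⟩

/-- The action of `{±1} × D∞` on `J₁₂`, as a homomorphism to the automorphism group. -/
def toAut : ℤˣ × DihedralGroup 0 →* autJ12 :=
  action.toHomUnits.codRestrict autJ12 action_isometry

theorem toAut_bijective : Function.Bijective toAut := by
  refine ⟨(injective_iff_map_eq_one _).mpr fun g hg => action_eq_one ?_, fun M => ?_⟩
  · exact congrArg (fun M : autJ12 => ((M : GL (Fin 2) ℤ) : Matrix (Fin 2) (Fin 2) ℤ)) hg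
  · obtain ⟨g, hg⟩ := exists_action_eq M.2
    exact ⟨g, Subtype.ext (Units.ext hg)⟩

end J12

/-- The automorphism group of the lattice `J₁₂` is isomorphic to the direct product of
`{±1}` and the infinite dihedral group. -/
theorem stmt9 : Nonempty (autJ12 ≃* ℤˣ × DihedralGroup 0) := by
  exact ⟨(MulEquiv.ofBijective J12.toAut J12.toAut_bijective).symm⟩
end

section
/- The integer matrices R₁ = !![1,2;0,-1] and R₂ = !![-1,0;6,1] satisfy R₁ᵀ·!![6,6;6,2]·R₁ = !![6,6;6,2] and R₂ᵀ·!![6,6;6,2]·R₂ = !![6,6;6,2] (they are isometries of J₁₂), R₁² = 1 and R₂² = 1, and the product R₁·R₂ = !![11,2;-6,-1] has infinite order: (R₁·R₂)ⁿ ≠ 1 for every integer n ≥ 1. -/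
open Matrix

/-- The first row `(a, b)` of a positive power of `!![11,2;-6,-1]` satisfies `0 < b` and
`2 * b ≤ a`. -/
theorem pow_succ_first_row (n : ℕ) :
    0 < ((!![11, 2; -6, -1] : Matrix (Fin 2) (Fin 2) ℤ) ^ (n + 1)) 0 1 ∧
    2 * ((!![11, 2; -6, -1] : Matrix (Fin 2) (Fin 2) ℤ) ^ (n + 1)) 0 1 ≤
      ((!![11, 2; -6, -1] : Matrix (Fin 2) (Fin 2) ℤ) ^ (n + 1)) 0 0 := by
  induction n with
  | zero => simp
  | succ k ih =>
    obtain ⟨hb, hab⟩ := ih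
    rw [pow_succ _ (k + 1)]
    simp only [Matrix.mul_apply, Fin.sum_univ_two, Matrix.of_apply, Matrix.cons_val_zero,
      Matrix.cons_val_one]
    constructor <;> linarith

/-- `R₁ = !![1,2;0,-1]` and `R₂ = !![-1,0;6,1]` are involutive isometries of the
lattice `J₁₂`, and their product `R₁·R₂ = !![11,2;-6,-1]` has infinite order. -/
theorem stmt10 :
    ((!![1, 2; 0, -1] : Matrix (Fin 2) (Fin 2) ℤ)ᵀ * !![6, 6; 6, 2] * !![1, 2; 0, -1]
        = !![6, 6; 6, 2]) ∧
    ((!![-1, 0; 6, 1] : Matrix (Fin 2) (Fin 2) ℤ)ᵀ * !![6, 6; 6, 2] * !![-1, 0; 6, 1]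
        = !![6, 6; 6, 2]) ∧
    ((!![1, 2; 0, -1] : Matrix (Fin 2) (Fin 2) ℤ) ^ 2 = 1) ∧
    ((!![-1, 0; 6, 1] : Matrix (Fin 2) (Fin 2) ℤ) ^ 2 = 1) ∧
    ((!![1, 2; 0, -1] : Matrix (Fin 2) (Fin 2) ℤ) * !![-1, 0; 6, 1] = !![11, 2; -6, -1]) ∧
    (∀ n : ℕ, 1 ≤ n →
      ((!![1, 2; 0, -1] : Matrix (Fin 2) (Fin 2) ℤ) * !![-1, 0; 6, 1]) ^ n ≠ 1) := by
  have hmul : (!![1, 2; 0, -1] : Matrix (Fin 2) (Fin 2) ℤ) * !![-1, 0; 6, 1] =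
      !![11, 2; -6, -1] := by decide
  refine ⟨by decide, by decide, by decide, by decide, hmul, fun n hn h => ?_⟩
  obtain ⟨k, rfl⟩ := Nat.exists_eq_add_of_le' hn
  rw [hmul] at h
  have hpos := (pow_succ_first_row k).1
  rw [h] at hpos
  simp at hpos
end

section
/- Let A = !![11,2;-6,-1], regarded as an element of GL(2,ℤ) (it has determinant 1). A vector v ∈ ℤ² satisfies q(v) = -10 if and only if there exists an integer n such that v = Aⁿ·w for some w among the four vectors (3,-2), (-3,2), (-1,2), (1,-2). Moreover, the four orbits {Aⁿ·(3,-2) : n ∈ ℤ}, {Aⁿ·(-3,2) : n ∈ ℤ}, {Aⁿ·(-1,2) : n ∈ ℤ}, {Aⁿ·(1,-2) : n ∈ ℤ} are pairwise disjoint. -/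
open Matrix

/-- The matrix `A = !![11,2;-6,-1]` as a unit (element of `GL(2,ℤ)`); its inverse is
`!![-1,-2;6,11]` and its determinant is `1`. -/
def AunitJ12 : (Matrix (Fin 2) (Fin 2) ℤ)ˣ where
  val := !![11, 2; -6, -1]
  inv := !![-1, -2; 6, 11]
  val_inv := by decide
  inv_val := by decide

/-- The orbit `{Aⁿ·w : n ∈ ℤ}` of a vector `w ∈ ℤ²` under the infinite-order isometry
`A = R₁R₂`. -/
def orbitJ12 (w : Fin 2 → ℤ) : Set (Fin 2 → ℤ) :=
  {v | ∃ n : ℤ, v = ((AunitJ12 ^ n : (Matrix (Fin 2) (Fin 2) ℤ)ˣ) :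
    Matrix (Fin 2) (Fin 2) ℤ).mulVec w}

/-- Half of the quadratic form of `J₁₂`. -/
def halfFormJ12 (v : Fin 2 → ℤ) : ℤ := 3 * v 0 ^ 2 + 6 * v 0 * v 1 + v 1 ^ 2

lemma AunitJ12_mulVec (v : Fin 2 → ℤ) :
    (AunitJ12 : Matrix (Fin 2) (Fin 2) ℤ).mulVec v = ![11 * v 0 + 2 * v 1, -6 * v 0 - v 1] := by
  ext i
  fin_cases i <;> simp [AunitJ12, Matrix.mulVec, dotProduct, Fin.sum_univ_two]
  ring

lemma AunitJ12_inv_mulVec (v : Fin 2 → ℤ) :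
    ((AunitJ12⁻¹ : (Matrix (Fin 2) (Fin 2) ℤ)ˣ) : Matrix (Fin 2) (Fin 2) ℤ).mulVec v =
      ![-v 0 - 2 * v 1, 6 * v 0 + 11 * v 1] := by
  change (!![-1, -2; 6, 11] : Matrix (Fin 2) (Fin 2) ℤ).mulVec v = _
  ext i
  fin_cases i <;> simp [Matrix.mulVec, dotProduct, Fin.sum_univ_two]
  ring

lemma self_mem_orbitJ12 (w : Fin 2 → ℤ) : w ∈ orbitJ12 w := ⟨0, by simp⟩

lemma zpow_mulVec_mem_orbitJ12_iff (k : ℤ) (v w : Fin 2 → ℤ) :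
    ((AunitJ12 ^ k : (Matrix (Fin 2) (Fin 2) ℤ)ˣ) : Matrix (Fin 2) (Fin 2) ℤ).mulVec v
      ∈ orbitJ12 w ↔ v ∈ orbitJ12 w := by
  constructor
  · rintro ⟨n, hn⟩
    refine ⟨-k + n, ?_⟩
    rw [_root_.zpow_add, Units.val_mul, ← Matrix.mulVec_mulVec, ← hn, Matrix.mulVec_mulVec,
      ← Units.val_mul, ← _root_.zpow_add]
    simp
  · rintro ⟨n, rfl⟩
    exact ⟨k + n, by rw [_root_.zpow_add, Units.val_mul, Matrix.mulVec_mulVec]⟩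

lemma apply_mem_orbitJ12_iff (v w : Fin 2 → ℤ) :
    ![11 * v 0 + 2 * v 1, -6 * v 0 - v 1] ∈ orbitJ12 w ↔ v ∈ orbitJ12 w := by
  simpa only [_root_.zpow_one, AunitJ12_mulVec] using zpow_mulVec_mem_orbitJ12_iff 1 v w

lemma inv_apply_mem_orbitJ12_iff (v w : Fin 2 → ℤ) :
    ![-v 0 - 2 * v 1, 6 * v 0 + 11 * v 1] ∈ orbitJ12 w ↔ v ∈ orbitJ12 w := by
  simpa only [_root_.zpow_neg_one, AunitJ12_inv_mulVec] using zpow_mulVec_mem_orbitJ12_iff (-1) v w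

lemma neg_mem_orbitJ12 {v w : Fin 2 → ℤ} (h : -v ∈ orbitJ12 w) : v ∈ orbitJ12 (-w) := by
  obtain ⟨n, hn⟩ := h
  exact ⟨n, by rw [Matrix.mulVec_neg, ← hn, neg_neg]⟩

lemma orbitJ12_induction {P : (Fin 2 → ℤ) → Prop} {w : Fin 2 → ℤ} (hw : P w)
    (hA : ∀ v, P v → P ![11 * v 0 + 2 * v 1, -6 * v 0 - v 1])
    (hA' : ∀ v, P v → P ![-v 0 - 2 * v 1, 6 * v 0 + 11 * v 1])
    {v : Fin 2 → ℤ} (hv : v ∈ orbitJ12 w) : P v := by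
  obtain ⟨n, rfl⟩ := hv
  induction n using Int.induction_on with
  | zero => simpa using hw
  | succ n ih =>
    rw [add_comm, _root_.zpow_one_add, Units.val_mul, ← Matrix.mulVec_mulVec, AunitJ12_mulVec]
    exact hA _ ih
  | pred n ih =>
    rw [sub_eq_neg_add, _root_.zpow_add, _root_.zpow_neg_one, Units.val_mul, ← Matrix.mulVec_mulVec,
      AunitJ12_inv_mulVec]
    exact hA' _ ih

lemma pos_iff_of_sq_lt_sq {x y : ℤ} (h : x ^ 2 < y ^ 2) : 0 < y + x ↔ 0 < y := by
  rw [sq_lt_sq] at h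
  grind

lemma orbitJ12_invariants {v w : Fin 2 → ℤ} (hw : halfFormJ12 w = -5) (hv : v ∈ orbitJ12 w) :
    halfFormJ12 v = -5 ∧ (0 < v 0 ↔ 0 < w 0) ∧ (5 ∣ v 1 + 4 * v 0 ↔ 5 ∣ w 1 + 4 * w 0) := by
  refine orbitJ12_induction (P := fun v => halfFormJ12 v = -5 ∧ (0 < v 0 ↔ 0 < w 0) ∧
    (5 ∣ v 1 + 4 * v 0 ↔ 5 ∣ w 1 + 4 * w 0)) ⟨hw, Iff.rfl, Iff.rfl⟩ ?_ ?_ hv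
  · rintro v ⟨hq, hpos, hdvd⟩
    simp only [halfFormJ12, Matrix.cons_val_zero, Matrix.cons_val_one] at hq ⊢
    refine ⟨by linear_combination hq, ?_, by omega⟩
    rw [← hpos]
    have := pos_iff_of_sq_lt_sq (x := 2 * (v 1 + 3 * v 0)) (y := 5 * v 0) (by nlinarith)
    omega
  · rintro v ⟨hq, hpos, hdvd⟩
    simp only [halfFormJ12, Matrix.cons_val_zero, Matrix.cons_val_one] at hq ⊢
    refine ⟨by linear_combination hq, ?_, by omega⟩
    rw [← hpos]
    have := pos_iff_of_sq_lt_sq (x := -2 * (v 1 + 3 * v 0)) (y := 5 * v 0) (by nlinarith)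
    omega

lemma disjoint_orbitJ12 {w₁ w₂ : Fin 2 → ℤ} (h₁ : halfFormJ12 w₁ = -5)
    (h₂ : halfFormJ12 w₂ = -5)
    (h : ¬((0 < w₁ 0 ↔ 0 < w₂ 0) ∧ (5 ∣ w₁ 1 + 4 * w₁ 0 ↔ 5 ∣ w₂ 1 + 4 * w₂ 0))) :
    Disjoint (orbitJ12 w₁) (orbitJ12 w₂) := by
  refine Set.disjoint_left.2 fun v hv₁ hv₂ => h ?_
  obtain ⟨-, hp₁, hd₁⟩ := orbitJ12_invariants h₁ hv₁
  obtain ⟨-, hp₂, hd₂⟩ := orbitJ12_invariants h₂ hv₂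
  exact ⟨hp₁.symm.trans hp₂, hd₁.symm.trans hd₂⟩

/-- Descent on the first coordinate, in terms of the equation `(b + 3a)² - 6a² = -5`. -/
lemma mem_orbitJ12_of_pos (v : Fin 2 → ℤ) (hq : halfFormJ12 v = -5) (hpos : 0 < v 0) :
    v ∈ orbitJ12 ![3, -2] ∨ v ∈ orbitJ12 ![1, -2] := by
  induction hn : (v 0).toNat using Nat.strong_induction_on generalizing v with
  | _ n ih =>
  have hsq : (v 1 + 3 * v 0) ^ 2 = 6 * v 0 ^ 2 - 5 := by
    unfold halfFormJ12 at hq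
    linear_combination hq
  rcases (show v 0 = 1 ∨ 2 ≤ v 0 by omega) with h1 | h2
  · have hb : v 1 = -2 ∨ v 1 = -4 := by
      have : (v 1 + 2) * (v 1 + 4) = 0 := by
        rw [h1] at hsq
        linear_combination hsq
      rcases mul_eq_zero.1 this with h | h <;> omega
    rcases hb with hb | hb
    · right
      convert self_mem_orbitJ12 ![1, -2]
      ext i
      fin_cases i <;> simp [h1, hb]
    · left
      rw [← apply_mem_orbitJ12_iff, h1, hb]
      exact self_mem_orbitJ12 _
  · rcases le_total 0 (v 1 + 3 * v 0) with hx | hx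
    · rw [← inv_apply_mem_orbitJ12_iff v ![3, -2], ← inv_apply_mem_orbitJ12_iff v ![1, -2]]
      have hlow : 2 * v 0 < v 1 + 3 * v 0 := by nlinarith
      have hhigh : 2 * (v 1 + 3 * v 0) < 5 * v 0 := by nlinarith
      refine ih (-v 0 - 2 * v 1).toNat (by omega) _ ?_ ?_ rfl
      · simp only [halfFormJ12, Matrix.cons_val_zero, Matrix.cons_val_one] at hq ⊢
        linear_combination hq
      · simp only [Matrix.cons_val_zero]
        omega
    · rw [← apply_mem_orbitJ12_iff v ![3, -2], ← apply_mem_orbitJ12_iff v ![1, -2]]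
      have hlow : 2 * v 0 < -(v 1 + 3 * v 0) := by nlinarith
      have hhigh : 2 * -(v 1 + 3 * v 0) < 5 * v 0 := by nlinarith
      refine ih (11 * v 0 + 2 * v 1).toNat (by omega) _ ?_ ?_ rfl
      · simp only [halfFormJ12, Matrix.cons_val_zero, Matrix.cons_val_one] at hq ⊢
        linear_combination hq
      · simp only [Matrix.cons_val_zero]
        omega

/-- A vector `v ∈ ℤ²` satisfies `q(v) = -10` iff it lies in the `⟨A⟩`-orbit of one of
`(3,-2)`, `(-3,2)`, `(-1,2)`, `(1,-2)`; and these four orbits are pairwise disjoint. -/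
theorem stmt11 :
    (∀ v : Fin 2 → ℤ,
      6 * (v 0) ^ 2 + 12 * (v 0) * (v 1) + 2 * (v 1) ^ 2 = -10 ↔
      ∃ w ∈ ({![3, -2], ![-3, 2], ![-1, 2], ![1, -2]} : Set (Fin 2 → ℤ)),
        v ∈ orbitJ12 w) ∧
    List.Pairwise (fun w₁ w₂ => Disjoint (orbitJ12 w₁) (orbitJ12 w₂))
      [![3, -2], ![-3, 2], ![-1, 2], ![1, -2]] := by
  have h₁ : halfFormJ12 ![3, -2] = -5 := by decide
  have h₂ : halfFormJ12 ![-3, 2] = -5 := by decide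
  have h₃ : halfFormJ12 ![-1, 2] = -5 := by decide
  have h₄ : halfFormJ12 ![1, -2] = -5 := by decide
  refine ⟨fun v => ⟨fun h => ?_, ?_⟩, ?_⟩
  · have hq : halfFormJ12 v = -5 := by
      unfold halfFormJ12
      linarith
    rcases lt_trichotomy (v 0) 0 with hneg | hzero | hpos
    · have hq' : halfFormJ12 (-v) = -5 := by
        simpa [halfFormJ12] using hq
      rcases mem_orbitJ12_of_pos (-v) hq' (by simpa using hneg) with hv | hv
      · exact ⟨![-3, 2], by simp, by simpa using neg_mem_orbitJ12 hv⟩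
      · exact ⟨![-1, 2], by simp, by simpa using neg_mem_orbitJ12 hv⟩
    · rw [hzero] at h
      nlinarith [sq_nonneg (v 1)]
    · rcases mem_orbitJ12_of_pos v hq hpos with hv | hv
      · exact ⟨![3, -2], by simp, hv⟩
      · exact ⟨![1, -2], by simp, hv⟩
  · rintro ⟨w, hw, hv⟩
    have hw' : halfFormJ12 w = -5 := by
      rcases hw with rfl | rfl | rfl | rfl <;> assumption
    have hq := (orbitJ12_invariants hw' hv).1
    unfold halfFormJ12 at hq
    linarith
  · have d₁₂ := disjoint_orbitJ12 h₁ h₂ (by decide)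
    have d₁₃ := disjoint_orbitJ12 h₁ h₃ (by decide)
    have d₁₄ := disjoint_orbitJ12 h₁ h₄ (by decide)
    have d₂₃ := disjoint_orbitJ12 h₂ h₃ (by decide)
    have d₂₄ := disjoint_orbitJ12 h₂ h₄ (by decide)
    have d₃₄ := disjoint_orbitJ12 h₃ h₄ (by decide)
    simp only [List.pairwise_cons, List.mem_cons, List.not_mem_nil, or_false, forall_eq_or_imp,
      forall_eq, false_imp_iff, implies_true, List.Pairwise.nil, and_true]
    exact ⟨⟨d₁₂, d₁₃, d₁₄⟩, ⟨d₂₃, d₂₄⟩, d₃₄⟩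
end

section
/- Define a sequence ρ : ℕ → ℤ² by ρ₀ = (3,-2), ρ₁ = (7,-4), and ρ_{n+2} = A·ρ_n where A = !![11,2;-6,-1]. Then for every n, q(ρ_n) = -10 and B(ρ_n, g) > 0, where g = (1,0). -/
open Matrix

/-- The sequence of `(-10)`-classes `ρ₀ = (3,-2)`, `ρ₁ = (7,-4)`,
`ρ_{n+2} = A·ρ_n` with `A = !![11,2;-6,-1]`. -/
def rhoSeq : ℕ → (Fin 2 → ℤ)
  | 0 => ![3, -2]
  | 1 => ![7, -4]
  | n + 2 => (!![11, 2; -6, -1] : Matrix (Fin 2) (Fin 2) ℤ).mulVec (rhoSeq n)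

theorem rhoSeq_add_two (n : ℕ) :
    rhoSeq (n + 2) 0 = 11 * rhoSeq n 0 + 2 * rhoSeq n 1 ∧
      rhoSeq (n + 2) 1 = -6 * rhoSeq n 0 - rhoSeq n 1 := by
  constructor <;> simp [rhoSeq, Matrix.mulVec, dotProduct, Fin.sum_univ_two]; ring

theorem rhoSeq_quadForm (n : ℕ) :
    6 * (rhoSeq n 0) ^ 2 + 12 * (rhoSeq n 0) * (rhoSeq n 1) + 2 * (rhoSeq n 1) ^ 2 = -10 := by
  induction n using Nat.twoStepInduction with
  | zero => simp [rhoSeq]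
  | one => simp [rhoSeq]
  | more n ih _ =>
    obtain ⟨h0, h1⟩ := rhoSeq_add_two n
    rw [h0, h1]
    linear_combination ih

theorem rhoSeq_pos (n : ℕ) : 0 < rhoSeq n 0 ∧ 0 < rhoSeq n 0 + rhoSeq n 1 := by
  induction n using Nat.twoStepInduction with
  | zero => simp [rhoSeq]
  | one => simp [rhoSeq]
  | more n ih _ =>
    obtain ⟨h0, h1⟩ := rhoSeq_add_two n
    omega

/-- Every `ρ_n` satisfies `q(ρ_n) = -10` and `B(ρ_n, g) > 0` where `g = (1,0)`. -/
theorem stmt13 (n : ℕ) :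
    6 * (rhoSeq n 0) ^ 2 + 12 * (rhoSeq n 0) * (rhoSeq n 1) + 2 * (rhoSeq n 1) ^ 2
        = -10 ∧
    0 < 6 * (rhoSeq n 0) * 1 + 6 * ((rhoSeq n 0) * 0 + 1 * (rhoSeq n 1))
        + 2 * (rhoSeq n 1) * 0 := by
  refine ⟨rhoSeq_quadForm n, ?_⟩
  have := (rhoSeq_pos n).2
  linarith
end

section
/- Let B_ℝ be the real bilinear form on ℝ² with Gram matrix !![6,6;6,2], and set ρ₁ = (3,-2), ρ₁^∨ = (-1,2), α₁ = (7,-3), α₁^∨ = (1,3). Then {x ∈ ℝ² : B_ℝ(x,ρ₁) ≥ 0 and B_ℝ(x,ρ₁^∨) ≥ 0} = {a·α₁ + b·α₁^∨ : a ≥ 0, b ≥ 0}; in particular B_ℝ(α₁,ρ₁) = B_ℝ(α₁^∨,ρ₁^∨) = 0 and B_ℝ(α₁,ρ₁^∨) = B_ℝ(α₁^∨,ρ₁) = 48. (The cone dual to Cone(ρ₁,ρ₁^∨) with respect to the Beauville–Bogomolov pairing is Cone(α₁,α₁^∨), the nef cone of F.) -/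
/-- The real extension of the Beauville-Bogomolov form of `J₁₂`, with Gram matrix
`!![6,6;6,2]` in the basis `g, τ`. -/
def B12 (x y : ℝ × ℝ) : ℝ :=
  6 * x.1 * y.1 + 6 * (x.1 * y.2 + y.1 * x.2) + 2 * x.2 * y.2

/-- The cone dual to `Cone(ρ₁,ρ₁^∨)` with respect to the Beauville–Bogomolov pairing is
`Cone(α₁,α₁^∨)`, where `ρ₁ = (3,-2)`, `ρ₁^∨ = (-1,2)`, `α₁ = (7,-3)`, `α₁^∨ = (1,3)`;
in particular `B(α₁,ρ₁) = B(α₁^∨,ρ₁^∨) = 0` and `B(α₁,ρ₁^∨) = B(α₁^∨,ρ₁) = 48`. -/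
theorem stmt14 :
    ({x : ℝ × ℝ | 0 ≤ B12 x ((3 : ℝ), (-2 : ℝ)) ∧ 0 ≤ B12 x ((-1 : ℝ), (2 : ℝ))}
        = {x : ℝ × ℝ | ∃ a b : ℝ, 0 ≤ a ∧ 0 ≤ b ∧
            x = a • ((7 : ℝ), (-3 : ℝ)) + b • ((1 : ℝ), (3 : ℝ))}) ∧
    B12 ((7 : ℝ), (-3 : ℝ)) ((3 : ℝ), (-2 : ℝ)) = 0 ∧
    B12 ((1 : ℝ), (3 : ℝ)) ((-1 : ℝ), (2 : ℝ)) = 0 ∧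
    B12 ((7 : ℝ), (-3 : ℝ)) ((-1 : ℝ), (2 : ℝ)) = 48 ∧
    B12 ((1 : ℝ), (3 : ℝ)) ((3 : ℝ), (-2 : ℝ)) = 48 := by
  refine ⟨?_, ?_, ?_, ?_, ?_⟩
  · ext ⟨x, y⟩
    simp only [B12, Set.mem_ofPred_eq, Prod.smul_mk, Prod.mk_add_mk, Prod.mk.injEq, smul_eq_mul]
    constructor
    · rintro ⟨h₁, h₂⟩
      refine ⟨(6 * x - 2 * y) / 48, (6 * x + 14 * y) / 48, ?_, ?_, ?_, ?_⟩ <;> linarith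
    · rintro ⟨a, b, ha, hb, rfl, rfl⟩
      constructor <;> linarith
  all_goals norm_num [B12]
end

section
/- Let k be an algebraically closed field of characteristic zero and F ∈ k[x₀,x₁,x₂,x₃,x₄] a homogeneous polynomial of degree 3. Suppose F vanishes at every point x ∈ k⁵ satisfying x₀x₃ = x₁x₂, x₀x₄ = x₂², and x₁x₄ = x₂x₃ (i.e., at every point where the matrix !![x₀,x₁,x₂; x₂,x₃,x₄] has rank at most 1). Then there exist homogeneous linear forms y₀, y₁, y₂ ∈ k[x₀,…,x₄] such that F equals the determinant of the 3×3 matrix with rows (x₀,x₁,x₂), (x₂,x₃,x₄), (y₀,y₁,y₂); equivalently, F = y₂(x₀x₃−x₁x₂) − y₁(x₀x₄−x₂²) + y₀(x₁x₄−x₂x₃). -/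
open MvPolynomial

/-- The degree `n + 2` part of the ideal of maximal minors of `!![x₀,x₁,x₂; x₂,x₃,x₄]`. -/
def scrollForms (k : Type*) [Field k] (n : ℕ) : Submodule k (MvPolynomial (Fin 5) k) where
  carrier := {F | ∃ y₀ y₁ y₂ : MvPolynomial (Fin 5) k,
      y₀.IsHomogeneous n ∧ y₁.IsHomogeneous n ∧ y₂.IsHomogeneous n ∧
      F = y₂ * (X 0 * X 3 - X 1 * X 2) - y₁ * (X 0 * X 4 - X 2 ^ 2)
          + y₀ * (X 1 * X 4 - X 2 * X 3)}
  add_mem' := by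
    rintro _ _ ⟨a, b, c, ha, hb, hc, rfl⟩ ⟨a', b', c', ha', hb', hc', rfl⟩
    exact ⟨a + a', b + b', c + c', ha.add ha', hb.add hb', hc.add hc', by ring⟩
  zero_mem' := ⟨0, 0, 0, isHomogeneous_zero _ _ _, isHomogeneous_zero _ _ _,
    isHomogeneous_zero _ _ _, by ring⟩
  smul_mem' := by
    rintro r _ ⟨a, b, c, ha, hb, hc, rfl⟩
    refine ⟨C r * a, C r * b, C r * c, ha.C_mul r, hb.C_mul r, hc.C_mul r, ?_⟩
    rw [smul_eq_C_mul]
    ring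

/-- The exponent of the image of a monomial under the parametrization
`(s², s b, s t, t b, t²)` of the scroll. -/
noncomputable def scrollExponent (m : Fin 5 →₀ ℕ) : Fin 3 →₀ ℕ :=
  Finsupp.equivFunOnFinite.symm
    ![2 * m 0 + m 1 + m 2, m 2 + m 3 + 2 * m 4, m 1 + m 3]

/-- The parametrization `(s², s b, s t, t b, t²)` of the scroll, as an algebra map. -/
noncomputable def scrollParam (k : Type*) [Field k] :
    MvPolynomial (Fin 5) k →ₐ[k] MvPolynomial (Fin 3) k :=
  aeval ![X 0 ^ 2, X 0 * X 2, X 0 * X 1, X 1 * X 2, X 1 ^ 2]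

theorem degree_fin_five (m : Fin 5 →₀ ℕ) : m.degree = m 0 + m 1 + m 2 + m 3 + m 4 := by
  rw [Finsupp.degree_eq_sum, Fin.sum_univ_five]

theorem scrollExponent_eq_iff {m m' : Fin 5 →₀ ℕ} :
    scrollExponent m = scrollExponent m' ↔
      2 * m 0 + m 1 + m 2 = 2 * m' 0 + m' 1 + m' 2 ∧
      m 2 + m 3 + 2 * m 4 = m' 2 + m' 3 + 2 * m' 4 ∧ m 1 + m 3 = m' 1 + m' 3 := by
  simp [scrollExponent]

theorem scrollParam_monomial (k : Type*) [Field k] (m : Fin 5 →₀ ℕ) :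
    scrollParam k (monomial m 1) = monomial (scrollExponent m) 1 := by
  rw [scrollParam, aeval_monomial, Finsupp.prod_fintype _ _ (fun _ => pow_zero _),
    monomial_eq, Finsupp.prod_fintype _ _ (fun _ => pow_zero _)]
  simp [Fin.prod_univ_succ, scrollExponent]
  ring

/-- A monomial divisible by `X i * X j` agrees with the monomial obtained by replacing this factor
by `X p * X q`, up to a homogeneous multiple of the binomial `X i * X j - X p * X q`. -/
theorem monomial_sub_monomial_exchange (k : Type*) [Field k] {n : ℕ} (m : Fin 5 →₀ ℕ)
    (hm : m.degree = n + 2) (i j p q : Fin 5) (hij : i ≠ j) (hi : m i ≠ 0) (hj : m j ≠ 0) :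
    ∃ m₀ : Fin 5 →₀ ℕ, m = m₀ + Finsupp.single i 1 + Finsupp.single j 1 ∧
      (monomial m₀ (1 : k)).IsHomogeneous n ∧
      monomial m (1 : k) - monomial (m₀ + Finsupp.single p 1 + Finsupp.single q 1) 1 =
        monomial m₀ 1 * (X i * X j - X p * X q) := by
  have hle : Finsupp.single i 1 + Finsupp.single j 1 ≤ m := by
    intro l
    simp only [Finsupp.add_apply, Finsupp.single_apply]
    split_ifs <;> grind
  obtain ⟨m₀, rfl⟩ := exists_add_of_le hle
  refine ⟨m₀, by abel, isHomogeneous_monomial _ ?_, ?_⟩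
  · simp only [map_add, Finsupp.degree_single] at hm
    omega
  · simp only [X, mul_sub, monomial_mul, mul_one]
    congr 2 <;> abel_nf

/-- Every monomial is congruent, modulo the minors, to one which is divisible by none of
`x₀x₃`, `x₀x₄`, `x₁x₄`. -/
theorem exists_standard_monomial (k : Type*) [Field k] {n : ℕ} (m : Fin 5 →₀ ℕ)
    (hm : m.degree = n + 2) :
    ∃ m' : Fin 5 →₀ ℕ, scrollExponent m' = scrollExponent m ∧
      (m' 0 = 0 ∨ m' 3 = 0) ∧ (m' 0 = 0 ∨ m' 4 = 0) ∧ (m' 1 = 0 ∨ m' 4 = 0) ∧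
      monomial m (1 : k) - monomial m' 1 ∈ scrollForms k n := by
  induction h : 4 * m 0 + m 1 + m 3 + 4 * m 4 using Nat.strong_induction_on generalizing m with
  | _ w ih =>
  have step (m₁ : Fin 5 →₀ ℕ) (he : scrollExponent m₁ = scrollExponent m)
      (hlt : 4 * m₁ 0 + m₁ 1 + m₁ 3 + 4 * m₁ 4 < w)
      (hmem : monomial m (1 : k) - monomial m₁ 1 ∈ scrollForms k n) :
      ∃ m' : Fin 5 →₀ ℕ, scrollExponent m' = scrollExponent m ∧
        (m' 0 = 0 ∨ m' 3 = 0) ∧ (m' 0 = 0 ∨ m' 4 = 0) ∧ (m' 1 = 0 ∨ m' 4 = 0) ∧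
        monomial m (1 : k) - monomial m' 1 ∈ scrollForms k n := by
    have hd : m₁.degree = n + 2 := by
      rw [scrollExponent_eq_iff] at he
      rw [degree_fin_five] at hm ⊢
      omega
    obtain ⟨m', he', h₁, h₂, h₃, hmem'⟩ := ih _ hlt m₁ hd rfl
    refine ⟨m', he'.trans he, h₁, h₂, h₃, ?_⟩
    simpa using add_mem hmem hmem'
  have hz := isHomogeneous_zero (Fin 5) k n
  by_cases h₁ : m 0 = 0 ∨ m 3 = 0
  · by_cases h₂ : m 0 = 0 ∨ m 4 = 0
    · by_cases h₃ : m 1 = 0 ∨ m 4 = 0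
      · exact ⟨m, rfl, h₁, h₂, h₃, by simp⟩
      · push Not at h₃
        obtain ⟨m₀, rfl, hh, hs⟩ :=
          monomial_sub_monomial_exchange k m hm 1 4 2 3 (by decide) h₃.1 h₃.2
        refine step _ (scrollExponent_eq_iff.2 ?_) ?_ ⟨_, _, _, hh, hz, hz, hs.trans (by ring)⟩
        · simp; omega
        · subst h; simp; omega
    · push Not at h₂
      obtain ⟨m₀, rfl, hh, hs⟩ :=
        monomial_sub_monomial_exchange k m hm 0 4 2 2 (by decide) h₂.1 h₂.2
      refine step _ (scrollExponent_eq_iff.2 ?_) ?_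
        ⟨_, _, _, hz, hh.neg, hz, hs.trans (by ring)⟩
      · simp; omega
      · subst h; simp; omega
  · push Not at h₁
    obtain ⟨m₀, rfl, hh, hs⟩ :=
      monomial_sub_monomial_exchange k m hm 0 3 1 2 (by decide) h₁.1 h₁.2
    refine step _ (scrollExponent_eq_iff.2 ?_) ?_ ⟨_, _, _, hz, hz, hh, hs.trans (by ring)⟩
    · simp; omega
    · subst h; simp; omega

theorem monomial_sub_monomial_mem_scrollForms (k : Type*) [Field k] {n : ℕ}
    {m m' : Fin 5 →₀ ℕ} (hm : m.degree = n + 2) (he : scrollExponent m = scrollExponent m') :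
    monomial m (1 : k) - monomial m' 1 ∈ scrollForms k n := by
  have hm' : m'.degree = n + 2 := by
    rw [scrollExponent_eq_iff] at he
    rw [degree_fin_five] at hm ⊢
    omega
  obtain ⟨a, ha, ha₁, ha₂, ha₃, hma⟩ := exists_standard_monomial k m hm
  obtain ⟨b, hb, hb₁, hb₂, hb₃, hmb⟩ := exists_standard_monomial k m' hm'
  have hab : a = b := by
    have := scrollExponent_eq_iff.1 (ha.trans (he.trans hb.symm))
    ext i
    fin_cases i <;> simp <;> omega
  subst hab
  simpa using sub_mem hma hmb

/-- A form of degree `n + 2` vanishing on the parametrized scroll is a combination of the minors. -/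
theorem mem_scrollForms_of_scrollParam_eq_zero {k : Type*} [Field k] {n : ℕ}
    {F : MvPolynomial (Fin 5) k} (hF : F.IsHomogeneous (n + 2)) (h : scrollParam k F = 0) :
    F ∈ scrollForms k n := by
  let L : MvPolynomial (Fin 3) k →ₗ[k] MvPolynomial (Fin 5) k :=
    (basisMonomials (Fin 3) k).constr k
      fun d => monomial (Function.invFun scrollExponent d) 1
  have hL (d : Fin 3 →₀ ℕ) : L (monomial d 1) =
      monomial (Function.invFun scrollExponent d) 1 := by
    rw [← show basisMonomials (Fin 3) k d = monomial d 1 from congrFun (coe_basisMonomials _ _) d]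
    exact (basisMonomials (Fin 3) k).constr_basis k _ d
  have key : F - L (scrollParam k F) = ∑ m ∈ F.support, F.coeff m •
      (monomial m (1 : k) - monomial (Function.invFun scrollExponent (scrollExponent m)) 1) := by
    have hsum : F = ∑ m ∈ F.support, F.coeff m • monomial m (1 : k) := by
      conv_lhs => rw [F.as_sum]
      simp [smul_monomial]
    conv_lhs => rw [hsum]
    simp only [map_sum, map_smul, scrollParam_monomial, hL, smul_sub, Finset.sum_sub_distrib]
  rw [h, map_zero, sub_zero] at key
  rw [key]
  refine sum_mem fun m hm => Submodule.smul_mem _ _ ?_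
  refine monomial_sub_monomial_mem_scrollForms k ?_ (Function.invFun_eq ⟨m, rfl⟩).symm
  rw [Finsupp.degree_eq_weight_one]
  exact hF (mem_support_iff.1 hm)

/-- Every homogeneous cubic on `ℙ⁴` containing the cubic scroll
`{rank !![x₀,x₁,x₂; x₂,x₃,x₄] ≤ 1}` is determinantal: it is the determinant of the
`3×3` matrix with rows `(x₀,x₁,x₂)`, `(x₂,x₃,x₄)`, `(y₀,y₁,y₂)` for suitable linear
forms `y₀,y₁,y₂`. -/
theorem stmt15 (k : Type*) [Field k] [IsAlgClosed k] [CharZero k]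
    (F : MvPolynomial (Fin 5) k) (hF : F.IsHomogeneous 3)
    (hvan : ∀ x : Fin 5 → k,
      x 0 * x 3 = x 1 * x 2 → x 0 * x 4 = x 2 ^ 2 → x 1 * x 4 = x 2 * x 3 →
      eval x F = 0) :
    ∃ y₀ y₁ y₂ : MvPolynomial (Fin 5) k,
      y₀.IsHomogeneous 1 ∧ y₁.IsHomogeneous 1 ∧ y₂.IsHomogeneous 1 ∧
      F = y₂ * (X 0 * X 3 - X 1 * X 2) - y₁ * (X 0 * X 4 - X 2 ^ 2)
          + y₀ * (X 1 * X 4 - X 2 * X 3) := by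
  have h : scrollParam k F = 0 := by
    refine MvPolynomial.funext fun x => ?_
    have hcomp : eval x (scrollParam k F) =
        eval (fun i => eval x ((![X 0 ^ 2, X 0 * X 2, X 0 * X 1, X 1 * X 2, X 1 ^ 2] :
          Fin 5 → MvPolynomial (Fin 3) k) i)) F := by
      rw [scrollParam, aeval_def, algebraMap_eq, eval_eval₂]
      congr 1
      ext
      simp
    rw [hcomp, map_zero]
    apply hvan <;> simp <;> ring
  exact mem_scrollForms_of_scrollParam_eq_zero hF h
end
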